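/- Let u_1 := [[0,1,0],[1,0,0],[0,0,1]] and u_2 := [[0,−i,0],[i,0,0],[0,0,0]] in M_3, so that u_1 + i·u_2 = [[0,2],[0,0]] ⊕ [1]. Then W(u_1,u_2) is the closed unit disk in ℝ², and the expected value map 𝔼|_{𝓜_3} is open at a state ρ ∈ 𝓜_3 if and only if 𝔼(ρ) ≠ (1,0) or ρ = v_1 v_1* where v_1 := (1/√2)·(1,1,0). In particular, the fiber 𝔼|_{𝓜_3}^{-1}((1,0)) is a three-dimensional ball and 𝔼|_{𝓜_3} is open at exactly one of its points. -/

import Mathlib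

open Set Filter Topology Matrix
open scoped ComplexOrder

/-- The joint numerical range `W(u₁,u₂) ⊆ ℝ²` of two (hermitian) matrices. -/
def jointNR {d : ℕ} (u₁ u₂ : Matrix (Fin d) (Fin d) ℂ) : Set (ℝ × ℝ) :=
  {p | ∃ x : Fin d → ℂ, star x ⬝ᵥ x = 1 ∧
    p = ((star x ⬝ᵥ u₁.mulVec x).re, (star x ⬝ᵥ u₂.mulVec x).re)}

/-- The state space `𝓜_d`: positive semidefinite matrices of trace one. -/
def stateSpace (d : ℕ) : Set (Matrix (Fin d) (Fin d) ℂ) :=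
  {ρ | ρ.PosSemidef ∧ ρ.trace = 1}

/-- The expected value map `ρ ↦ (tr(u₁ρ), tr(u₂ρ))` (real for hermitian arguments). -/
noncomputable def expVal2 {d : ℕ} (u₁ u₂ : Matrix (Fin d) (Fin d) ℂ)
    (ρ : Matrix (Fin d) (Fin d) ℂ) : ℝ × ℝ :=
  ((u₁ * ρ).trace.re, (u₂ * ρ).trace.re)

/-- `f` restricted to `K` (viewed as a map onto `L`, both with subspace topologies) is open at
`v ∈ K` if the image of every neighborhood of `v` in `K` is a neighborhood of `f v` in `L`. -/
def MapsOpenAt {X Y : Type*} [TopologicalSpace X] [TopologicalSpace Y]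
    (f : X → Y) (K : Set X) (L : Set Y) (v : X) : Prop :=
  ∀ N : Set X, N ⊆ K → N ∈ nhdsWithin v K → f '' N ∈ nhdsWithin (f v) L

/-- A supporting line of `C` at `p`: the level set of a nonzero linear functional attaining
its maximum over `C` at `p`. -/
def IsSupportingLineAt (C : Set (ℝ × ℝ)) (p : ℝ × ℝ) (l : Set (ℝ × ℝ)) : Prop :=
  ∃ (φ : (ℝ × ℝ) →ₗ[ℝ] ℝ) (c : ℝ), φ ≠ 0 ∧ l = {q | φ q = c} ∧ φ p = c ∧ ∀ q ∈ C, φ q ≤ c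

/-- A corner point of `C`: a point of `C` lying on more than one supporting line. -/
def IsCornerPoint (C : Set (ℝ × ℝ)) (p : ℝ × ℝ) : Prop :=
  p ∈ C ∧ ∃ l₁ l₂ : Set (ℝ × ℝ), l₁ ≠ l₂ ∧ IsSupportingLineAt C p l₁ ∧ IsSupportingLineAt C p l₂

/-- A round boundary point of `C`: a boundary point which is neither a corner point nor lies
in the relative interior of a flat boundary portion (a nondegenerate segment in the boundary). -/
def IsRoundBoundaryPoint (C : Set (ℝ × ℝ)) (p : ℝ × ℝ) : Prop :=
  p ∈ frontier C ∧ ¬ IsCornerPoint C p ∧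
    ¬ ∃ a b : ℝ × ℝ, a ≠ b ∧ segment ℝ a b ⊆ frontier C ∧ p ∈ openSegment ℝ a b

/-- `z` is singularly generated if all unit vectors generating it are proportional. -/
def SinglyGenerated {d : ℕ} (u₁ u₂ : Matrix (Fin d) (Fin d) ℂ) (z : ℝ × ℝ) : Prop :=
  ∀ x y : Fin d → ℂ, star x ⬝ᵥ x = 1 → star y ⬝ᵥ y = 1 →
    ((star x ⬝ᵥ u₁.mulVec x).re, (star x ⬝ᵥ u₂.mulVec x).re) = z →
    ((star y ⬝ᵥ u₁.mulVec y).re, (star y ⬝ᵥ u₂.mulVec y).re) = z →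
    ∃ c : ℂ, y = c • x

/-- `z` is multiply generated if it lies in the joint numerical range but is not
singularly generated. -/
def MultiplyGenerated {d : ℕ} (u₁ u₂ : Matrix (Fin d) (Fin d) ℂ) (z : ℝ × ℝ) : Prop :=
  z ∈ jointNR u₁ u₂ ∧ ¬ SinglyGenerated u₁ u₂ z

/-- A matrix is unitarily reducible if it is unitarily equivalent to a block diagonal matrix
with (at least) two proper diagonal blocks. -/
def UnitarilyReducible {d : ℕ} (A : Matrix (Fin d) (Fin d) ℂ) : Prop :=
  ∃ (a b : ℕ) (hab : a + b = d), 0 < a ∧ 0 < b ∧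
    ∃ U ∈ Matrix.unitaryGroup (Fin d) ℂ,
      ∃ (B : Matrix (Fin a) (Fin a) ℂ) (C : Matrix (Fin b) (Fin b) ℂ),
        star U * A * U =
          Matrix.reindex (finSumFinEquiv.trans (finCongr hab))
            (finSumFinEquiv.trans (finCongr hab)) (Matrix.fromBlocks B 0 0 C)

/-- A simplex is the convex hull of finitely many affinely independent points. -/
def IsSimplex {Y : Type*} [AddCommGroup Y] [Module ℝ Y] (S : Set Y) : Prop :=
  ∃ s : Finset Y, AffineIndependent ℝ (fun p : (s : Set Y) => (p : Y)) ∧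
    S = convexHull ℝ (s : Set Y)

/-- `w` is a simplicial point of `C` if finitely many simplices contained in `C`
cover a neighborhood of `w` in `C`. -/
def IsSimplicialPoint {Y : Type*} [AddCommGroup Y] [Module ℝ Y] [TopologicalSpace Y]
    (C : Set Y) (w : Y) : Prop :=
  ∃ (m : ℕ) (S : Fin m → Set Y),
    (∀ i, IsSimplex (S i) ∧ S i ⊆ C) ∧ (⋃ i, S i) ∈ nhdsWithin w C

/-- A face of a convex set `C`: a convex subset `F ⊆ C` such that any segment of `C` whose
relative interior meets `F` lies in `F` (i.e. `F` is convex and extreme in `C`). -/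
def IsFaceOf {Y : Type*} [AddCommGroup Y] [Module ℝ Y] (C F : Set Y) : Prop :=
  Convex ℝ F ∧ IsExtreme ℝ C F

/-- The dimension of a convex set: the dimension of its affine hull. -/
noncomputable def convDim {Y : Type*} [NormedAddCommGroup Y] [NormedSpace ℝ Y]
    (C : Set Y) : ℕ :=
  Module.finrank ℝ (affineSpan ℝ C).direction

/-- `u₁ = [[0,1,0],[1,0,0],[0,0,1]]`. -/
noncomputable def aOne : Matrix (Fin 3) (Fin 3) ℂ := !![0, 1, 0; 1, 0, 0; 0, 0, 1]

/-- `u₂ = [[0,-i,0],[i,0,0],[0,0,0]]`. -/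
noncomputable def aTwo : Matrix (Fin 3) (Fin 3) ℂ :=
  !![0, -Complex.I, 0; Complex.I, 0, 0; 0, 0, 0]

/-- The unit vector `v₁ = (1/√2)·(1,1,0)`. -/
noncomputable def vOne : Fin 3 → ℂ := ![(Real.sqrt 2 : ℂ)⁻¹, (Real.sqrt 2 : ℂ)⁻¹, 0]

theorem expVal2_aOne_aTwo (ρ : Matrix (Fin 3) (Fin 3) ℂ) :
    expVal2 aOne aTwo ρ =
      ((ρ 1 0).re + (ρ 0 1).re + (ρ 2 2).re, (ρ 1 0).im - (ρ 0 1).im) := by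
  simp only [expVal2, Matrix.trace_fin_three, Matrix.mul_apply, Fin.sum_univ_three]
  ext
  · simp [aOne]
  · simp [aTwo]
    ring

theorem vecMulVec_mem_stateSpace {d : ℕ} {x : Fin d → ℂ} (hx : star x ⬝ᵥ x = 1) :
    vecMulVec x (star x) ∈ stateSpace d := by
  refine ⟨Matrix.posSemidef_vecMulVec_self_star x, ?_⟩
  rw [Matrix.trace_vecMulVec, dotProduct_comm, hx]

theorem expVal2_vecMulVec {d : ℕ} (u₁ u₂ : Matrix (Fin d) (Fin d) ℂ) (x : Fin d → ℂ) :
    expVal2 u₁ u₂ (vecMulVec x (star x)) =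
      ((star x ⬝ᵥ u₁.mulVec x).re, (star x ⬝ᵥ u₂.mulVec x).re) := by
  simp only [expVal2, Matrix.mul_vecMulVec, Matrix.trace_vecMulVec, dotProduct_comm]

theorem convex_stateSpace (d : ℕ) : Convex ℝ (stateSpace d) := by
  rintro ρ ⟨hρ, hρt⟩ σ ⟨hσ, hσt⟩ a b ha hb hab
  refine ⟨(hρ.smul ha).add (hσ.smul hb), ?_⟩
  rw [Matrix.trace_add, Matrix.trace_smul, Matrix.trace_smul, hρt, hσt, ← add_smul, hab, one_smul]

/-- The entries of a state of size three satisfy the minor inequalities. -/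
theorem stateSpace_three_entries {ρ : Matrix (Fin 3) (Fin 3) ℂ} (hρ : ρ ∈ stateSpace 3) :
    (∀ i, 0 ≤ (ρ i i).re ∧ (ρ i i).im = 0) ∧ (∀ i j, ρ i j = star (ρ j i)) ∧
    (ρ 0 0).re + (ρ 1 1).re + (ρ 2 2).re = 1 ∧
    (∀ i j, (ρ i j).re ^ 2 + (ρ i j).im ^ 2 ≤ (ρ i i).re * (ρ j j).re) := by
  obtain ⟨hp, ht⟩ := hρ
  have hd : ∀ i, 0 ≤ (ρ i i).re ∧ (ρ i i).im = 0 := fun i => by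
    have h := hp.diag_nonneg (i := i)
    rw [Complex.le_def] at h
    exact ⟨h.1, h.2.symm⟩
  have hh : ∀ i j, ρ i j = star (ρ j i) := fun i j => (hp.1.apply i j).symm
  refine ⟨hd, hh, ?_, fun i j => ?_⟩
  · have := congrArg Complex.re ht
    simpa [Matrix.trace_fin_three] using this
  · have h := (hp.submatrix ![i, j]).det_nonneg
    rw [Matrix.det_fin_two] at h
    have h1 := (Complex.le_def.1 h).1
    have h2 := hh j i
    simp only [Matrix.submatrix_apply, Matrix.cons_val_zero, Matrix.cons_val_one] at h1
    rw [h2] at h1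
    simp [Complex.mul_re, (hd i).2, (hd j).2] at h1
    nlinarith

theorem expVal2_mem_disk {ρ : Matrix (Fin 3) (Fin 3) ℂ} (hρ : ρ ∈ stateSpace 3) :
    (expVal2 aOne aTwo ρ).1 ^ 2 + (expVal2 aOne aTwo ρ).2 ^ 2 ≤ 1 := by
  obtain ⟨hd, hh, ht, hm⟩ := stateSpace_three_entries hρ
  have h := hm 1 0
  have hd0 := (hd 0).1
  have hd1 := (hd 1).1
  have hd2 := (hd 2).1
  rw [expVal2_aOne_aTwo, hh 0 1]
  simp only [Complex.star_def, Complex.conj_re, Complex.conj_im]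
  generalize (ρ 0 0).re = a at *
  generalize (ρ 1 1).re = b at *
  generalize (ρ 2 2).re = d at *
  generalize (ρ 1 0).re = p at *
  generalize (ρ 1 0).im = q at *
  have h1 : 4 * (p ^ 2 + q ^ 2) ≤ (1 - d) ^ 2 := by
    have : 1 - d = a + b := by linarith
    rw [this]; nlinarith [sq_nonneg (a - b)]
  have h2 : 2 * p ≤ 1 - d := by
    apply le_of_sq_le_sq _ (by linarith)
    nlinarith [sq_nonneg q]
  nlinarith [mul_le_mul_of_nonneg_right h2 hd2]

/-- Over a point of the unit circle, either the point is `(1, 0)`, or the `(2, 2)` entry of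
the state vanishes. In both cases the upper left block is determined by the `(2, 2)` entry. -/
theorem entries_of_mem_circle {ρ : Matrix (Fin 3) (Fin 3) ℂ} (hρ : ρ ∈ stateSpace 3)
    (hz : (expVal2 aOne aTwo ρ).1 ^ 2 + (expVal2 aOne aTwo ρ).2 ^ 2 = 1) :
    ((ρ 2 2).re = 0 ∨ (2 * (ρ 1 0).re = 1 - (ρ 2 2).re ∧ (ρ 1 0).im = 0)) ∧
      (ρ 0 0).re = (1 - (ρ 2 2).re) / 2 ∧ (ρ 1 1).re = (1 - (ρ 2 2).re) / 2 := by
  obtain ⟨hd, hh, ht, hm⟩ := stateSpace_three_entries hρ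
  have h := hm 1 0
  have hd0 := (hd 0).1
  have hd1 := (hd 1).1
  have hd2 := (hd 2).1
  rw [expVal2_aOne_aTwo, hh 0 1] at hz
  simp only [Complex.star_def, Complex.conj_re, Complex.conj_im] at hz
  generalize (ρ 0 0).re = a at *
  generalize (ρ 1 1).re = b at *
  generalize (ρ 2 2).re = d at *
  generalize (ρ 1 0).re = p at *
  generalize (ρ 1 0).im = q at *
  have hab : 1 - d = a + b := by linarith
  have h1 : 4 * (p ^ 2 + q ^ 2) + (a - b) ^ 2 ≤ (1 - d) ^ 2 := by
    rw [hab]; nlinarith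
  have h2 : 2 * p ≤ 1 - d := by
    apply le_of_sq_le_sq _ (by linarith)
    nlinarith [sq_nonneg q, sq_nonneg (a - b)]
  have h3 : (a - b) ^ 2 = 0 := by
    nlinarith [mul_le_mul_of_nonneg_right h2 hd2, sq_nonneg (a - b)]
  have h4 : a = b := by nlinarith [pow_eq_zero_iff (two_ne_zero) |>.1 h3]
  refine ⟨?_, by linarith, by linarith⟩
  by_cases hd0 : d = 0
  · exact Or.inl hd0
  right
  have h5 : d * (1 - d - 2 * p) = 0 := by
    nlinarith [mul_le_mul_of_nonneg_right h2 hd2, sq_nonneg (a - b)]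
  have h6 : 2 * p = 1 - d := by
    rcases mul_eq_zero.1 h5 with h | h
    · exact absurd h hd0
    · linarith
  exact ⟨h6, by nlinarith⟩

theorem entry_two_two_eq_zero_of_mem_circle {ρ : Matrix (Fin 3) (Fin 3) ℂ}
    (hρ : ρ ∈ stateSpace 3)
    (hz : (expVal2 aOne aTwo ρ).1 ^ 2 + (expVal2 aOne aTwo ρ).2 ^ 2 = 1)
    (hne : expVal2 aOne aTwo ρ ≠ (1, 0)) : (ρ 2 2).re = 0 := by
  obtain ⟨h | ⟨h1, h2⟩, -⟩ := entries_of_mem_circle hρ hz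
  · exact h
  · refine absurd ?_ hne
    rw [expVal2_aOne_aTwo, (stateSpace_three_entries hρ).2.1 0 1]
    ext
    · simp; linarith
    · simp [h2]

/-- A continuous choice of states over the unit disk, supported on the first two coordinates. -/
noncomputable def diskSection (z : ℝ × ℝ) : Matrix (Fin 3) (Fin 3) ℂ :=
  !![((1 + √(1 - z.1 ^ 2 - z.2 ^ 2)) / 2 : ℝ), ⟨z.1 / 2, -z.2 / 2⟩, 0;
    ⟨z.1 / 2, z.2 / 2⟩, ((1 - √(1 - z.1 ^ 2 - z.2 ^ 2)) / 2 : ℝ), 0;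
    0, 0, 0]

theorem continuous_complex_mk {X : Type*} [TopologicalSpace X] {f g : X → ℝ}
    (hf : Continuous f) (hg : Continuous g) : Continuous fun x => (⟨f x, g x⟩ : ℂ) :=
  Complex.equivRealProdCLM.symm.continuous.comp (hf.prodMk hg)

theorem continuous_diskSection : Continuous diskSection := by
  refine continuous_matrix fun i j => ?_
  fin_cases i <;> fin_cases j <;> simp only [diskSection, Matrix.of_apply] <;>
    first
    | exact continuous_const
    | exact Complex.continuous_ofReal.comp (by fun_prop)
    | exact continuous_complex_mk (by fun_prop) (by fun_prop)

theorem expVal2_diskSection (z : ℝ × ℝ) : expVal2 aOne aTwo (diskSection z) = z := by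
  rw [expVal2_aOne_aTwo]
  ext
  · simp [diskSection]
  · simp [diskSection]
    ring

theorem exists_diskSection_eq_vecMulVec {z : ℝ × ℝ} (hz : z.1 ^ 2 + z.2 ^ 2 ≤ 1) :
    ∃ x : Fin 3 → ℂ, star x ⬝ᵥ x = 1 ∧ diskSection z = vecMulVec x (star x) := by
  have hc0 := Real.sqrt_nonneg (1 - z.1 ^ 2 - z.2 ^ 2)
  have hc := Real.sq_sqrt (show 0 ≤ 1 - z.1 ^ 2 - z.2 ^ 2 by linarith)
  set c := √(1 - z.1 ^ 2 - z.2 ^ 2) with hcdef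
  have hs := Real.sq_sqrt (show 0 ≤ (1 + c) / 2 by linarith)
  have hs0 : 0 < √((1 + c) / 2) := Real.sqrt_pos.2 (by linarith)
  set s := √((1 + c) / 2) with hsdef
  have hs1 : z.1 / (2 * s) * (z.1 / (2 * s)) + z.2 / (2 * s) * (z.2 / (2 * s)) = (1 - c) / 2 := by
    field_simp
    rw [hs]
    nlinarith
  have hEq : diskSection z = vecMulVec ![(s : ℂ), ⟨z.1 / (2 * s), z.2 / (2 * s)⟩, 0]
      (star ![(s : ℂ), ⟨z.1 / (2 * s), z.2 / (2 * s)⟩, 0]) := by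
    ext i j
    fin_cases i <;> fin_cases j <;> apply Complex.ext <;>
      simp [diskSection, vecMulVec_apply, ← hcdef]
    all_goals first | (field_simp; done) | (field_simp; ring_nf; done) | nlinarith
  refine ⟨_, ?_, hEq⟩
  rw [dotProduct_comm, ← Matrix.trace_vecMulVec, ← hEq, Matrix.trace_fin_three]
  simp [diskSection]
  ring

theorem diskSection_mem_stateSpace {z : ℝ × ℝ} (hz : z.1 ^ 2 + z.2 ^ 2 ≤ 1) :
    diskSection z ∈ stateSpace 3 := by
  obtain ⟨x, hx, h⟩ := exists_diskSection_eq_vecMulVec hz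
  exact h ▸ vecMulVec_mem_stateSpace hx

theorem jointNR_aOne_aTwo : jointNR aOne aTwo = {p : ℝ × ℝ | p.1 ^ 2 + p.2 ^ 2 ≤ 1} := by
  ext p
  constructor
  · rintro ⟨x, hx, rfl⟩
    rw [← expVal2_vecMulVec]
    exact expVal2_mem_disk (vecMulVec_mem_stateSpace hx)
  · intro hp
    obtain ⟨x, hx, h⟩ := exists_diskSection_eq_vecMulVec hp
    exact ⟨x, hx, by rw [← expVal2_vecMulVec, ← h, expVal2_diskSection]⟩

theorem star_vOne_dotProduct_vOne : star vOne ⬝ᵥ vOne = 1 := by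
  have h : (√2 : ℂ) * (√2 : ℂ) = 2 := by
    rw [← Complex.ofReal_mul, Real.mul_self_sqrt (by norm_num)]; norm_num
  simp [vOne, dotProduct, Fin.sum_univ_three, ← mul_inv, h]
  norm_num

theorem vecMulVec_vOne :
    vecMulVec vOne (star vOne) = !![1 / 2, 1 / 2, 0; 1 / 2, 1 / 2, 0; 0, 0, 0] := by
  have h : (√2 : ℂ) * (√2 : ℂ) = 2 := by
    rw [← Complex.ofReal_mul, Real.mul_self_sqrt (by norm_num)]; norm_num
  ext i j
  fin_cases i <;> fin_cases j <;> simp [vOne, vecMulVec_apply, ← mul_inv, h]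

theorem diskSection_one_zero : diskSection (1, 0) = vecMulVec vOne (star vOne) := by
  rw [vecMulVec_vOne]
  ext i j
  fin_cases i <;> fin_cases j <;> apply Complex.ext <;> simp [diskSection]

/-- Over the unit circle, a state with vanishing `(2, 2)` entry lies on the section. -/
theorem eq_diskSection_of_mem_circle {ρ : Matrix (Fin 3) (Fin 3) ℂ} (hρ : ρ ∈ stateSpace 3)
    (hz : (expVal2 aOne aTwo ρ).1 ^ 2 + (expVal2 aOne aTwo ρ).2 ^ 2 = 1)
    (h22 : (ρ 2 2).re = 0) : ρ = diskSection (expVal2 aOne aTwo ρ) := by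
  obtain ⟨-, h00, h11⟩ := entries_of_mem_circle hρ hz
  obtain ⟨hd, hh, ht, hm⟩ := stateSpace_three_entries hρ
  have hzero : ∀ i, ρ i 2 = 0 := fun i => by
    have := hm i 2
    rw [h22, mul_zero] at this
    apply Complex.ext <;> simp <;> nlinarith [sq_nonneg (ρ i 2).re, sq_nonneg (ρ i 2).im]
  have hzero' : ∀ i, ρ 2 i = 0 := fun i => by rw [hh, hzero, star_zero]
  have hs : 1 - (expVal2 aOne aTwo ρ).1 ^ 2 - (expVal2 aOne aTwo ρ).2 ^ 2 = 0 := by linarith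
  ext i j
  rw [diskSection, hs, expVal2_aOne_aTwo, hh 0 1]
  fin_cases i <;> fin_cases j <;> apply Complex.ext <;>
    simp [hzero, hzero', h00, h11, (hd 0).2, (hd 1).2]
  all_goals rw [hh 0 1]; simp

theorem MapsOpenAt.of_section {X Y : Type*} [TopologicalSpace X] [TopologicalSpace Y]
    {f : X → Y} {K : Set X} {L : Set Y} {v : X} (g : Y → X)
    (hg : ContinuousWithinAt g L (f v)) (hgv : g (f v) = v) (hgK : MapsTo g L K)
    (hfg : ∀ w ∈ L, f (g w) = w) : MapsOpenAt f K L v := by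
  intro N _ hN
  have ht : Tendsto g (𝓝[L] (f v)) (𝓝[K] v) := by
    have := hg.tendsto_nhdsWithin hgK
    rwa [hgv] at this
  filter_upwards [ht hN, self_mem_nhdsWithin] with w hw hwL
  exact ⟨g w, hw, hfg w hwL⟩

theorem expVal2_lineMap {d : ℕ} (u₁ u₂ : Matrix (Fin d) (Fin d) ℂ)
    (ρ σ : Matrix (Fin d) (Fin d) ℂ) (t : ℝ) :
    expVal2 u₁ u₂ ((1 - t) • ρ + t • σ) =
      (1 - t) • expVal2 u₁ u₂ ρ + t • expVal2 u₁ u₂ σ := by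
  simp [expVal2, mul_add]

theorem mapsOpenAt_of_mem_interior {ρ : Matrix (Fin 3) (Fin 3) ℂ} (hρ : ρ ∈ stateSpace 3)
    (hz : (expVal2 aOne aTwo ρ).1 ^ 2 + (expVal2 aOne aTwo ρ).2 ^ 2 < 1) :
    MapsOpenAt (expVal2 aOne aTwo) (stateSpace 3) (jointNR aOne aTwo) ρ := by
  intro N _ hN
  obtain ⟨U, hU, hUN⟩ := mem_nhdsWithin_iff_exists_mem_nhds_inter.1 hN
  have hdisk : IsCompact {p : ℝ × ℝ | p.1 ^ 2 + p.2 ^ 2 ≤ 1} := by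
    refine (isCompact_Icc (a := ((-1, -1) : ℝ × ℝ)) (b := (1, 1))).of_isClosed_subset
      (isClosed_le (by fun_prop) (by fun_prop)) fun p hp => ?_
    have hp' : p.1 ^ 2 + p.2 ^ 2 ≤ 1 := hp
    have h1 := abs_le.1 ((sq_le_one_iff_abs_le_one p.1).1 (by nlinarith [sq_nonneg p.2]))
    have h2 := abs_le.1 ((sq_le_one_iff_abs_le_one p.2).1 (by nlinarith [sq_nonneg p.1]))
    exact ⟨⟨h1.1, h2.1⟩, ⟨h1.2, h2.2⟩⟩
  have hcont : Continuous fun q : ℝ × (ℝ × ℝ) => (1 - q.1) • ρ + q.1 • diskSection q.2 := by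
    have := continuous_diskSection
    fun_prop
  have hev : ∀ᶠ t : ℝ in 𝓝 0, ∀ w ∈ {p : ℝ × ℝ | p.1 ^ 2 + p.2 ^ 2 ≤ 1},
      (1 - t) • ρ + t • diskSection w ∈ U :=
    hdisk.eventually_forall_of_forall_eventually fun w _ =>
      hcont.continuousAt (x := ((0 : ℝ), w)) (by simpa using hU)
  obtain ⟨t, ht, ht1, ht0⟩ :=
    ((hev.filter_mono nhdsWithin_le_nhds).and
      ((eventually_le_nhds (zero_lt_one' ℝ)).filter_mono nhdsWithin_le_nhds |>.and
        (self_mem_nhdsWithin : Ioi (0 : ℝ) ∈ 𝓝[>] 0))).exists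
  have ht0 : 0 < t := ht0
  set z := expVal2 aOne aTwo ρ with hzdef
  have hopen : IsOpen {w : ℝ × ℝ |
      (z + t⁻¹ • (w - z)).1 ^ 2 + (z + t⁻¹ • (w - z)).2 ^ 2 < 1} :=
    isOpen_lt (by fun_prop) (by fun_prop)
  filter_upwards [mem_nhdsWithin_of_mem_nhds (hopen.mem_nhds (by simpa using hz))] with w hw
  have hw' := le_of_lt (show _ < _ from hw)
  refine ⟨_, hUN ⟨ht _ hw', convex_stateSpace 3 hρ (diskSection_mem_stateSpace hw')
    (sub_nonneg.2 ht1) ht0.le (by ring)⟩, ?_⟩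
  rw [expVal2_lineMap, expVal2_diskSection, ← hzdef, smul_add, smul_inv_smul₀ ht0.ne']
  module

theorem mapsOpenAt_of_eq_diskSection {ρ : Matrix (Fin 3) (Fin 3) ℂ}
    (h : ρ = diskSection (expVal2 aOne aTwo ρ)) :
    MapsOpenAt (expVal2 aOne aTwo) (stateSpace 3) (jointNR aOne aTwo) ρ := by
  rw [jointNR_aOne_aTwo]
  exact MapsOpenAt.of_section diskSection continuous_diskSection.continuousWithinAt h.symm
    (fun w hw => diskSection_mem_stateSpace hw) fun w _ => expVal2_diskSection w

theorem mapsOpenAt_of_expVal2_ne {ρ : Matrix (Fin 3) (Fin 3) ℂ} (hρ : ρ ∈ stateSpace 3)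
    (hne : expVal2 aOne aTwo ρ ≠ (1, 0)) :
    MapsOpenAt (expVal2 aOne aTwo) (stateSpace 3) (jointNR aOne aTwo) ρ := by
  rcases (expVal2_mem_disk hρ).lt_or_eq with h | h
  · exact mapsOpenAt_of_mem_interior hρ h
  · exact mapsOpenAt_of_eq_diskSection
      (eq_diskSection_of_mem_circle hρ h (entry_two_two_eq_zero_of_mem_circle hρ h hne))

theorem eq_of_mapsOpenAt_of_expVal2_eq {ρ : Matrix (Fin 3) (Fin 3) ℂ} (hρ : ρ ∈ stateSpace 3)
    (hz : expVal2 aOne aTwo ρ = (1, 0))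
    (hopen : MapsOpenAt (expVal2 aOne aTwo) (stateSpace 3) (jointNR aOne aTwo) ρ) :
    ρ = vecMulVec vOne (star vOne) := by
  have hcirc : (expVal2 aOne aTwo ρ).1 ^ 2 + (expVal2 aOne aTwo ρ).2 ^ 2 = 1 := by simp [hz]
  rw [← diskSection_one_zero, ← hz]
  refine eq_diskSection_of_mem_circle hρ hcirc ?_
  by_contra h22
  have hpos : 0 < (ρ 2 2).re :=
    lt_of_le_of_ne ((stateSpace_three_entries hρ).1 2).1 (Ne.symm h22)
  have hU : IsOpen {σ : Matrix (Fin 3) (Fin 3) ℂ | 0 < (σ 2 2).re} :=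
    isOpen_lt (by fun_prop) (Complex.continuous_re.comp (by fun_prop))
  have himg := hopen (stateSpace 3 ∩ {σ | 0 < (σ 2 2).re}) inter_subset_left
    (inter_mem self_mem_nhdsWithin (mem_nhdsWithin_of_mem_nhds (hU.mem_nhds hpos)))
  rw [hz, jointNR_aOne_aTwo] at himg
  have ht : Tendsto (fun θ : ℝ => (Real.cos θ, Real.sin θ)) (𝓝[>] 0)
      (𝓝[{p : ℝ × ℝ | p.1 ^ 2 + p.2 ^ 2 ≤ 1}] (1, 0)) := by
    refine tendsto_nhdsWithin_iff.2 ⟨?_, Eventually.of_forall fun θ => ?_⟩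
    · have : Continuous fun θ : ℝ => (Real.cos θ, Real.sin θ) := by fun_prop
      simpa using (this.tendsto 0).mono_left nhdsWithin_le_nhds
    · simp
  obtain ⟨θ, ⟨σ, ⟨hσ, hσpos⟩, hσθ⟩, hθpi, hθ0⟩ := ((ht.eventually himg).and
    ((eventually_lt_nhds Real.pi_pos).filter_mono nhdsWithin_le_nhds |>.and
      (self_mem_nhdsWithin : Ioi (0 : ℝ) ∈ 𝓝[>] 0))).exists
  have hsin := Real.sin_pos_of_pos_of_lt_pi hθ0 hθpi
  refine (ne_of_gt hσpos) (entry_two_two_eq_zero_of_mem_circle hσ ?_ ?_)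
  · simp [hσθ]
  · rw [hσθ]
    exact fun h => hsin.ne' (congrArg Prod.snd h)

theorem expVal2_vOne : expVal2 aOne aTwo (vecMulVec vOne (star vOne)) = (1, 0) := by
  rw [← diskSection_one_zero, expVal2_diskSection]

theorem mapsOpenAt_vOne : MapsOpenAt (expVal2 aOne aTwo) (stateSpace 3) (jointNR aOne aTwo)
    (vecMulVec vOne (star vOne)) :=
  mapsOpenAt_of_eq_diskSection (by rw [expVal2_vOne, diskSection_one_zero])

/-- The linear part of the Bloch ball parametrization of the fiber over `(1, 0)`. -/
noncomputable def blochLinear : EuclideanSpace ℝ (Fin 3) →ₗ[ℝ] Matrix (Fin 3) (Fin 3) ℂ where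
  toFun p :=
    !![(p 0 / 4 : ℝ), (p 0 / 4 : ℝ), (⟨p 1 / (2 * √2), p 2 / (2 * √2)⟩ : ℂ);
      (p 0 / 4 : ℝ), (p 0 / 4 : ℝ), (⟨p 1 / (2 * √2), p 2 / (2 * √2)⟩ : ℂ);
      (⟨p 1 / (2 * √2), -p 2 / (2 * √2)⟩ : ℂ), (⟨p 1 / (2 * √2), -p 2 / (2 * √2)⟩ : ℂ), (-p 0 / 2 : ℝ)]
  map_add' p q := by
    ext i j
    fin_cases i <;> fin_cases j <;> apply Complex.ext <;> simp <;> ring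
  map_smul' c p := by
    ext i j
    fin_cases i <;> fin_cases j <;> apply Complex.ext <;> simp <;> ring

/-- The Bloch ball parametrization of the fiber over `(1, 0)`. -/
noncomputable def blochAffine : EuclideanSpace ℝ (Fin 3) →ᵃ[ℝ] Matrix (Fin 3) (Fin 3) ℂ :=
  blochLinear.toAffineMap + AffineMap.const ℝ _ !![1 / 4, 1 / 4, 0; 1 / 4, 1 / 4, 0; 0, 0, 1 / 2]

theorem blochAffine_apply (p : EuclideanSpace ℝ (Fin 3)) : blochAffine p =
    !![(((1 + p 0) / 4 : ℝ) : ℂ), (((1 + p 0) / 4 : ℝ) : ℂ),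
        (⟨p 1 / (2 * √2), p 2 / (2 * √2)⟩ : ℂ);
      (((1 + p 0) / 4 : ℝ) : ℂ), (((1 + p 0) / 4 : ℝ) : ℂ),
        (⟨p 1 / (2 * √2), p 2 / (2 * √2)⟩ : ℂ);
      (⟨p 1 / (2 * √2), -p 2 / (2 * √2)⟩ : ℂ),
        (⟨p 1 / (2 * √2), -p 2 / (2 * √2)⟩ : ℂ),
        (((1 - p 0) / 2 : ℝ) : ℂ)] := by
  ext i j
  fin_cases i <;> fin_cases j <;> apply Complex.ext <;>
    simp [blochAffine, blochLinear] <;> ring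

theorem blochAffine_injective : Function.Injective blochAffine := by
  intro p q h
  rw [blochAffine_apply, blochAffine_apply] at h
  have h00 := congrArg Complex.re (congrFun (congrFun h 0) 0)
  have h02 := congrFun (congrFun h 0) 2
  have hr := congrArg Complex.re h02
  have hi := congrArg Complex.im h02
  simp at h00 hr hi
  ext i
  fin_cases i
  · simpa using by linarith
  · simpa using hr
  · simpa using hi

theorem mem_closedBall_three {p : EuclideanSpace ℝ (Fin 3)} :
    p ∈ Metric.closedBall 0 1 ↔ p 0 ^ 2 + p 1 ^ 2 + p 2 ^ 2 ≤ 1 := by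
  rw [mem_closedBall_zero_iff, EuclideanSpace.norm_eq, Real.sqrt_le_one, Fin.sum_univ_three]
  simp

theorem blochAffine_posSemidef {p : EuclideanSpace ℝ (Fin 3)}
    (hp : p 0 ^ 2 + p 1 ^ 2 + p 2 ^ 2 ≤ 1) : (blochAffine p).PosSemidef := by
  have h2 : √2 ^ 2 = 2 := Real.sq_sqrt (by norm_num)
  have h20 : 0 < √2 := by positivity
  have habs := abs_le.1 ((sq_le_one_iff_abs_le_one (p 0)).1
    (by nlinarith [sq_nonneg (p 1), sq_nonneg (p 2)]))
  have hdiag : ∀ δ : ℝ, 0 ≤ δ → (Matrix.diagonal ![0, 0, (δ : ℂ)]).PosSemidef := fun δ hδ => by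
    refine Matrix.PosSemidef.diagonal fun i => ?_
    fin_cases i <;> simp [hδ]
  rcases habs.1.eq_or_lt with h | h
  · have h1 : p 1 = 0 := by nlinarith [sq_nonneg (p 1), sq_nonneg (p 2)]
    have h2 : p 2 = 0 := by nlinarith [sq_nonneg (p 1), sq_nonneg (p 2)]
    convert hdiag 1 zero_le_one
    rw [blochAffine_apply, ← h, h1, h2]
    ext i j
    fin_cases i <;> fin_cases j <;> apply Complex.ext <;> simp
  · set s := √((1 + p 0) / 4) with hsdef
    have hs : s ^ 2 = (1 + p 0) / 4 := Real.sq_sqrt (by linarith)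
    have hs' : s * s = (1 + p 0) / 4 := by rw [← sq, hs]
    have hs0 : 0 < s := Real.sqrt_pos.2 (by linarith)
    obtain ⟨δ, hδ⟩ : ∃ δ, δ = (1 - p 0) / 2 - (p 1 ^ 2 + p 2 ^ 2) / (2 * (1 + p 0)) := ⟨_, rfl⟩
    have hδ0 : 0 ≤ δ := by
      rw [hδ, sub_nonneg, div_le_div_iff₀ (by linarith) (by norm_num)]
      nlinarith
    have e1 : (p 1 / (2 * √2 * s)) ^ 2 + (p 2 / (2 * √2 * s)) ^ 2 = (1 - p 0) / 2 - δ := by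
      rw [hδ, show 1 + p 0 = 4 * s ^ 2 by linarith]
      field_simp
      rw [h2]
      ring
    convert (Matrix.posSemidef_vecMulVec_self_star
      ![(s : ℂ), s, ⟨p 1 / (2 * √2 * s), -(p 2 / (2 * √2 * s))⟩]).add (hdiag δ hδ0)
    have e2 : ∀ r : ℝ, s * (r / (2 * √2 * s)) = r / (2 * √2) := fun r => by field_simp
    have e3 : ∀ r : ℝ, r / (2 * √2 * s) * s = r / (2 * √2) := fun r => by field_simp
    rw [blochAffine_apply]
    ext i j
    fin_cases i <;> fin_cases j <;> apply Complex.ext <;>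
      rw [Matrix.add_apply, vecMulVec_apply] <;> simp [e2, e3, neg_div, hs']
    · linarith
    · ring

theorem image_blochAffine : blochAffine '' Metric.closedBall 0 1 =
    {ρ ∈ stateSpace 3 | expVal2 aOne aTwo ρ = (1, 0)} := by
  have h2 : √2 ^ 2 = 2 := Real.sq_sqrt (by norm_num)
  ext ρ
  constructor
  · rintro ⟨p, hp, rfl⟩
    refine ⟨⟨blochAffine_posSemidef (mem_closedBall_three.1 hp), ?_⟩, ?_⟩
    · rw [blochAffine_apply, Matrix.trace_fin_three]
      apply Complex.ext <;> simp
      ring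
    · rw [expVal2_aOne_aTwo, blochAffine_apply]
      ext <;> simp
      ring
  · rintro ⟨hρ, hz⟩
    obtain ⟨-, h00, h11⟩ := entries_of_mem_circle hρ (by simp [hz])
    obtain ⟨hd, hh, ht, hm⟩ := stateSpace_three_entries hρ
    rw [expVal2_aOne_aTwo, hh 0 1, Prod.ext_iff] at hz
    simp at hz
    obtain ⟨hz1, hz2⟩ := hz
    have hre : (ρ 1 0).re = (1 - (ρ 2 2).re) / 2 := by linarith
    have him : (ρ 1 0).im = 0 := by linarith
    have h12 : ρ 1 2 = ρ 0 2 := by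
      have hdet := (Complex.le_def.1 hρ.1.det_nonneg).1
      have m0 := hm 0 2
      have m1 := hm 1 2
      have hd0 := (hd 0).1
      rw [Matrix.det_fin_three, hh 0 1, hh 2 0, hh 2 1] at hdet
      simp [(hd 0).2, (hd 1).2, (hd 2).2, h00, h11, hre, him] at hdet
      rw [h00] at m0 hd0
      rw [h11] at m1
      generalize (ρ 2 2).re = d at *
      apply Complex.ext
      all_goals
        generalize (ρ 1 2).re = a at *
        generalize (ρ 1 2).im = b at *
        generalize (ρ 0 2).re = e at *
        generalize (ρ 0 2).im = f at *
        have : (a - e) ^ 2 + (b - f) ^ 2 ≤ 0 := by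
          rcases hd0.eq_or_lt with h | h
          · rw [← h, zero_mul] at m0 m1
            nlinarith [sq_nonneg (a + e), sq_nonneg (b + f)]
          · by_contra! hc
            nlinarith [mul_pos h hc]
        nlinarith [sq_nonneg (a - e), sq_nonneg (b - f)]
    have m0 := hm 0 2
    rw [h00] at m0
    refine ⟨!₂[1 - 2 * (ρ 2 2).re, 2 * √2 * (ρ 0 2).re, 2 * √2 * (ρ 0 2).im],
      mem_closedBall_three.2 ?_, ?_⟩
    · simp [mul_pow]
      nlinarith
    · rw [blochAffine_apply]
      ext i j
      fin_cases i <;> fin_cases j <;> apply Complex.ext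
      all_goals simp [h00, h11, hh 2 0, hh 2 1, hh 0 1, h12, hre, him, hd, neg_div]
      all_goals ring
  
theorem openness_characterization_for_disk_with_multiply_generated_point :
    (aOne + Complex.I • aTwo =
      Matrix.reindex (finSumFinEquiv (m := 2) (n := 1)) (finSumFinEquiv (m := 2) (n := 1))
        (Matrix.fromBlocks !![0, 2; 0, 0] 0 0 !![1])) ∧
    (jointNR aOne aTwo = {p : ℝ × ℝ | p.1 ^ 2 + p.2 ^ 2 ≤ 1}) ∧
    (∀ ρ ∈ stateSpace 3,
      MapsOpenAt (expVal2 aOne aTwo) (stateSpace 3) (jointNR aOne aTwo) ρ ↔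
        (expVal2 aOne aTwo ρ ≠ (1, 0) ∨ ρ = Matrix.vecMulVec vOne (star vOne))) ∧
    (∃ T : EuclideanSpace ℝ (Fin 3) →ᵃ[ℝ] Matrix (Fin 3) (Fin 3) ℂ,
      Function.Injective T ∧
      T '' Metric.closedBall 0 1 = {ρ ∈ stateSpace 3 | expVal2 aOne aTwo ρ = (1, 0)}) ∧
    (∃! ρ : Matrix (Fin 3) (Fin 3) ℂ, ρ ∈ stateSpace 3 ∧ expVal2 aOne aTwo ρ = (1, 0) ∧
      MapsOpenAt (expVal2 aOne aTwo) (stateSpace 3) (jointNR aOne aTwo) ρ) := by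
  refine ⟨?_, jointNR_aOne_aTwo, fun ρ hρ => ⟨fun h => ?_, ?_⟩,
    ⟨blochAffine, blochAffine_injective, image_blochAffine⟩,
    vecMulVec vOne (star vOne),
    ⟨vecMulVec_mem_stateSpace star_vOne_dotProduct_vOne, expVal2_vOne, mapsOpenAt_vOne⟩,
    fun ρ ⟨hρ, hz, hopen⟩ => eq_of_mapsOpenAt_of_expVal2_eq hρ hz hopen⟩
  · refine (Equiv.symm_apply_eq _).1 ?_
    have e0 : finSumFinEquiv (Sum.inl 0 : Fin 2 ⊕ Fin 1) = (0 : Fin 3) := rfl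
    have e1 : finSumFinEquiv (Sum.inl 1 : Fin 2 ⊕ Fin 1) = (1 : Fin 3) := rfl
    have e2 : finSumFinEquiv (Sum.inr 0 : Fin 2 ⊕ Fin 1) = (2 : Fin 3) := rfl
    ext i j
    rcases i with i | i <;> rcases j with j | j <;> fin_cases i <;> fin_cases j <;>
      simp [aOne, aTwo, e0, e1, e2]
    norm_num
  · by_cases hz : expVal2 aOne aTwo ρ = (1, 0)
    · exact Or.inr (eq_of_mapsOpenAt_of_expVal2_eq hρ hz h)
    · exact Or.inl hz
  · rintro (h | rfl)
    · exact mapsOpenAt_of_expVal2_ne hρ h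
    · exact mapsOpenAt_vOne
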